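/- arXiv:2501.06766 — 2 statements merged into one kernel-verified Lean document; each statement's English description precedes it below -/
import Mathlib

section
/- Let M be an n-feature classifier and c ∈ {0,1} a class. If φ, ψ ∈ L_n are both ≤-minimal (cardinality-minimal) global necessary reasons for c w.r.t. M, then Mod(φ) = Mod(ψ). -/
/-- An n-instance: a binary vector of length n. -/
abbrev Inst (n : ℕ) := Fin n → Bool

/-- Terms: constants 0/1 or feature variables v_i. -/
inductive Term (n : ℕ) : Type where
  | const : Bool → Term n
  | var : Fin n → Term n
  deriving DecidableEq

/-- A literal t ◊ t' with ◊ ∈ {=, ≠} (isEq = true means `=`). -/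
structure Lit (n : ℕ) : Type where
  isEq : Bool
  lhs : Term n
  rhs : Term n
  deriving DecidableEq

def Term.eval {n : ℕ} (x : Inst n) : Term n → Bool
  | .const b => b
  | .var i => x i

/-- Satisfaction of a literal by an instance. -/
def Lit.sat {n : ℕ} (x : Inst n) (ℓ : Lit n) : Prop :=
  if ℓ.isEq then ℓ.lhs.eval x = ℓ.rhs.eval x else ℓ.lhs.eval x ≠ ℓ.rhs.eval x

/-- A condition: a finite conjunction of literals. -/
abbrev Cond (n : ℕ) := List (Lit n)

/-- Models of a condition. -/
def Mods {n : ℕ} (φ : Cond n) : Set (Inst n) := {x | ∀ ℓ ∈ φ, ℓ.sat x}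

/-- Models of a single literal. -/
def ModsL {n : ℕ} (ℓ : Lit n) : Set (Inst n) := {x | ℓ.sat x}

/-- Instances classified with class c by classifier M. -/
def ModsM {n : ℕ} (M : Inst n → Bool) (c : Bool) : Set (Inst n) := {x | M x = c}

/-- A condition entails a literal. -/
def Entails {n : ℕ} (φ : Cond n) (ℓ : Lit n) : Prop := Mods φ ⊆ ModsL ℓ

/-- φ is a global necessary reason for class c w.r.t. classifier M. -/
def GNR {n : ℕ} (M : Inst n → Bool) (c : Bool) (φ : Cond n) : Prop :=
  ModsM M c ⊆ Mods φ

theorem Mods_append {n : ℕ} (φ ψ : Cond n) : Mods (φ ++ ψ) = Mods φ ∩ Mods ψ := by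
  ext x
  simp only [Mods, Set.mem_ofPred_eq, Set.mem_inter_iff, List.forall_mem_append]

/-- A necessary reason that no necessary reason beats in cardinality entails every necessary
reason. -/
theorem Mods_subset_of_minimal {n : ℕ} {M : Inst n → Bool} {c : Bool} {φ ψ : Cond n}
    (hφ : GNR M c φ) (hψ : GNR M c ψ)
    (hmin : ¬ ∃ χ : Cond n, GNR M c χ ∧ (Mods χ).ncard < (Mods φ).ncard) :
    Mods φ ⊆ Mods ψ := by
  by_contra h
  have hand : GNR M c (φ ++ ψ) := by
    unfold GNR
    rw [Mods_append]
    exact Set.subset_inter hφ hψ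
  refine hmin ⟨φ ++ ψ, hand, Set.ncard_lt_ncard ?_ (Set.toFinite _)⟩
  rw [Mods_append]
  exact Set.inter_ssubset_left_iff.mpr h

/-- Any two ≤-minimal (cardinality-minimal) global necessary reasons have the same models. -/
theorem stmt7 {n : ℕ} (hn : 1 ≤ n) (M : Inst n → Bool) (c : Bool) (φ ψ : Cond n)
    (hφ : GNR M c φ) (hψ : GNR M c ψ)
    (hφmin : ¬ ∃ χ : Cond n, GNR M c χ ∧ (Mods χ).ncard < (Mods φ).ncard)
    (hψmin : ¬ ∃ χ : Cond n, GNR M c χ ∧ (Mods χ).ncard < (Mods ψ).ncard) :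
    Mods φ = Mods ψ := by
  exact (Mods_subset_of_minimal hφ hψ hφmin).antisymm (Mods_subset_of_minimal hψ hφ hψmin)
end

section
/- Let w ∈ ℚ^n, b ∈ ℚ, and let i ≠ j be indices in {1, …, n}. Define x̂ ∈ {0,1}^n by: x̂_k = 1 if w_k ≥ 0 and x̂_k = 0 otherwise, for every k ∉ {i, j}; and (x̂_i, x̂_j) = (1, 0) if w_i ≥ w_j, and (x̂_i, x̂_j) = (0, 1) otherwise. Then there exists x ∈ {0,1}^n with x_i ≠ x_j and x·w + b ≥ 0 if and only if x̂·w + b ≥ 0. -/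
/-- Dot product of a binary vector (regarded as a rational vector) with w ∈ ℚ^n. -/
def dotB {n : ℕ} (x : Fin n → Bool) (w : Fin n → ℚ) : ℚ :=
  ∑ i, if x i then w i else 0

theorem dotB_eq_add_add_sum_erase {n : ℕ} (x : Fin n → Bool) (w : Fin n → ℚ) {i j : Fin n}
    (hij : i ≠ j) :
    dotB x w = (if x i then w i else 0) + ((if x j then w j else 0) +
      ∑ k ∈ (Finset.univ.erase i).erase j, if x k then w k else 0) := by
  rw [dotB, Finset.add_sum_erase _ (fun k => if x k then w k else 0)
      (Finset.mem_erase.2 ⟨hij.symm, Finset.mem_univ j⟩),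
    Finset.add_sum_erase _ (fun k => if x k then w k else 0) (Finset.mem_univ i)]

/-- Satisfiability of x·w + b ≥ 0 under the constraint x_i ≠ x_j is witnessed by the
canonical candidate x̂. -/
theorem stmt14 {n : ℕ} (hn : 1 ≤ n) (w : Fin n → ℚ) (b : ℚ) (i j : Fin n) (hij : i ≠ j) :
    (∃ x : Fin n → Bool, x i ≠ x j ∧ 0 ≤ dotB x w + b) ↔
      0 ≤ dotB (fun k => if k = i then decide (w j ≤ w i)
                         else if k = j then !decide (w j ≤ w i)
                         else decide (0 ≤ w k)) w + b := by
  constructor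
  · rintro ⟨x, hx, h⟩
    refine h.trans (add_le_add_left ?_ b)
    rw [dotB_eq_add_add_sum_erase _ w hij, dotB_eq_add_add_sum_erase _ w hij,
      ← add_assoc, ← add_assoc]
    refine add_le_add ?_ (Finset.sum_le_sum fun k hk => ?_)
    · grind
    · obtain ⟨hkj, hki, -⟩ : k ≠ j ∧ k ≠ i ∧ True := by simpa using hk
      grind
  · intro h
    exact ⟨_, by simp [hij.symm], h⟩
end
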